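/- For every integer k ≥ 0 and n = 6k + 4, the star graph on (3n² − 5n + 20)/6 = 18k² + 19k + 8 vertices is a vertex-minor of the n×n grid graph. -/

import Mathlib

/-- A finite simple graph with an explicit vertex set inside an ambient type `α`. -/
structure FGraph (α : Type*) where
  verts : Set α
  Adj : α → α → Prop
  symm : ∀ {a b}, Adj a b → Adj b a
  loopless : ∀ a, ¬ Adj a a
  edge_mem : ∀ {a b}, Adj a b → a ∈ verts ∧ b ∈ verts

namespace FGraph

variable {α : Type*}

/-- Local complementation at `v`: two distinct vertices are adjacent iff exactly one of
(adjacent in `G`) or (both neighbours of `v` in `G`) holds. -/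
def LC (G : FGraph α) (v : α) : FGraph α where
  verts := G.verts
  Adj a b := a ≠ b ∧ Xor' (G.Adj a b) (G.Adj v a ∧ G.Adj v b)
  symm := by
    rintro a b ⟨hne, h⟩
    refine ⟨hne.symm, ?_⟩
    rcases h with ⟨h1, h2⟩ | ⟨h1, h2⟩
    · exact Or.inl ⟨G.symm h1, fun hx => h2 ⟨hx.2, hx.1⟩⟩
    · exact Or.inr ⟨⟨h1.2, h1.1⟩, fun hx => h2 (G.symm hx)⟩
  loopless := fun a h => h.1 rfl
  edge_mem := by
    rintro a b ⟨hne, h⟩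
    rcases h with ⟨h1, _⟩ | ⟨⟨ha, hb⟩, _⟩
    · exact G.edge_mem h1
    · exact ⟨(G.edge_mem ha).2, (G.edge_mem hb).2⟩

/-- Z measurement at `v`: delete the vertex `v` together with all incident edges. -/
def ZM (G : FGraph α) (v : α) : FGraph α where
  verts := G.verts \ {v}
  Adj a b := G.Adj a b ∧ a ≠ v ∧ b ≠ v
  symm := fun h => ⟨G.symm h.1, h.2.2, h.2.1⟩
  loopless := fun a h => G.loopless a h.1
  edge_mem := by
    rintro a b ⟨h, ha, hb⟩
    exact ⟨⟨(G.edge_mem h).1, ha⟩, ⟨(G.edge_mem h).2, hb⟩⟩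

/-- X measurement at `u` with chosen neighbour `w`:
`X_u(G) = LC_w(Z_u(LC_u(LC_w(G))))`. -/
def XM (G : FGraph α) (u w : α) : FGraph α :=
  ((((G.LC w).LC u).ZM u).LC w)

/-- Y measurement at `v`: `Y_v(G) = Z_v(LC_v(G))`. -/
def YM (G : FGraph α) (v : α) : FGraph α :=
  (G.LC v).ZM v

/-- `G` is a star graph with centre `c`. -/
def IsStar (G : FGraph α) (c : α) : Prop :=
  c ∈ G.verts ∧
    ∀ a b, G.Adj a b ↔ (a ≠ b ∧ a ∈ G.verts ∧ b ∈ G.verts ∧ (a = c ∨ b = c))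

/-- `G` is a complete graph on its vertex set. -/
def IsComplete (G : FGraph α) : Prop :=
  ∀ a b, G.Adj a b ↔ (a ≠ b ∧ a ∈ G.verts ∧ b ∈ G.verts)

/-- One step of local complementation or vertex deletion. -/
inductive Step : FGraph α → FGraph α → Prop
  | lc (G : FGraph α) (v : α) : Step G (G.LC v)
  | del (G : FGraph α) (v : α) : Step G (G.ZM v)

/-- `H` is a vertex-minor of `G`: `H` is obtained from `G` by a finite sequence of
local complementations and vertex deletions. -/
def IsVertexMinor (H G : FGraph α) : Prop :=
  Relation.ReflTransGen Step G H

/-- One step of local complementation. -/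
inductive LCStep : FGraph α → FGraph α → Prop
  | lc (G : FGraph α) (v : α) : LCStep G (G.LC v)

/-- `H` is obtained from `G` by a finite sequence of local complementations. -/
def LCReach (G H : FGraph α) : Prop :=
  Relation.ReflTransGen LCStep G H

end FGraph

/-- The `n × n` grid graph: vertices `{0,…,n-1} × {0,…,n-1}`, two vertices being
adjacent iff they agree in one coordinate and differ by exactly 1 in the other. -/
def gridGraph (n : ℕ) : FGraph (ℕ × ℕ) where
  verts := {p | p.1 < n ∧ p.2 < n}
  Adj p q := p.1 < n ∧ p.2 < n ∧ q.1 < n ∧ q.2 < n ∧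
    ((p.1 = q.1 ∧ (p.2 + 1 = q.2 ∨ q.2 + 1 = p.2)) ∨
     (p.2 = q.2 ∧ (p.1 + 1 = q.1 ∨ q.1 + 1 = p.1)))
  symm := by
    rintro p q ⟨h1, h2, h3, h4, (⟨he, hd⟩ | ⟨he, hd⟩)⟩
    · exact ⟨h3, h4, h1, h2, Or.inl ⟨he.symm, hd.symm⟩⟩
    · exact ⟨h3, h4, h1, h2, Or.inr ⟨he.symm, hd.symm⟩⟩
  loopless := by
    rintro p ⟨_, _, _, _, (⟨_, hd⟩ | ⟨_, hd⟩)⟩ <;> omega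
  edge_mem := by
    rintro p q ⟨h1, h2, h3, h4, _⟩
    exact ⟨⟨h1, h2⟩, ⟨h3, h4⟩⟩

namespace FGraph

variable {α : Type*}

theorem LC_adj_iff (G : FGraph α) (v a b : α) :
    (G.LC v).Adj a b ↔ a ≠ b ∧ Xor (G.Adj a b) (G.Adj v a ∧ G.Adj v b) :=
  Iff.rfl

theorem exists_isVertexMinor_delete [DecidableEq α] (G : FGraph α) (D : Finset α) :
    ∃ H : FGraph α, IsVertexMinor H G ∧ H.verts = G.verts \ ↑D ∧
      ∀ a b, H.Adj a b ↔ G.Adj a b ∧ a ∉ D ∧ b ∉ D := by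
  induction D using Finset.induction_on with
  | empty => exact ⟨G, Relation.ReflTransGen.refl, by simp, by simp⟩
  | insert v D _ ih =>
    obtain ⟨H, hH, hv, hadj⟩ := ih
    refine ⟨H.ZM v, hH.tail (Step.del H v), ?_, fun a b => ?_⟩
    · ext x
      simp only [ZM, hv, Set.mem_sdiff, Finset.mem_coe, Set.mem_singleton_iff, Finset.mem_insert]
      tauto
    · simp only [ZM, hadj, Finset.mem_insert]
      tauto

theorem isVertexMinor_XM (G : FGraph α) (u w : α) : IsVertexMinor (G.XM u w) G :=
  (((Relation.ReflTransGen.single (Step.lc G w)).tail (Step.lc _ u)).tail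
    (Step.del _ u)).tail (Step.lc _ w)

/-- An X measurement at a vertex `m` of degree two with non-adjacent neighbours `c` and `s`
makes `s` a leaf at `c` and adds the other edges of `s` to `c` modulo two. -/
theorem XM_adj_iff (H : FGraph α) {m c s : α} (hcs : c ≠ s) (hns : ¬ H.Adj s c)
    (hm : ∀ x, H.Adj m x ↔ x = c ∨ x = s) (a b : α) :
    (H.XM m s).Adj a b ↔ a ≠ m ∧ b ≠ m ∧ a ≠ b ∧
      ((a = s ∧ b = c) ∨ (a = c ∧ b = s) ∨
        (a ≠ s ∧ b ≠ s ∧ Xor (H.Adj a b) ((a = c ∧ H.Adj s b) ∨ (b = c ∧ H.Adj s a)))) := by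
  have hsm : H.Adj s m := H.symm ((hm s).2 (Or.inr rfl))
  have hmm := H.loopless m
  have hss := H.loopless s
  have hmc : m ≠ c := by rintro rfl; exact hmm ((hm m).2 (Or.inl rfl))
  have hms : m ≠ s := by rintro rfl; exact hmm ((hm m).2 (Or.inr rfl))
  have h1 : ∀ x, (H.LC s).Adj m x ↔ x ≠ m ∧ (x = c ∨ x = s ∨ H.Adj s x) := by
    intro x
    simp only [LC_adj_iff, hm, xor_def]
    grind
  have h2 : ∀ x, ((H.LC s).LC m).Adj s x ↔ x = m ∨ x = c := by
    intro x
    simp only [LC_adj_iff, xor_def] at h1 ⊢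
    grind
  have hsymm : ∀ x, H.Adj x s ↔ H.Adj s x := fun x => ⟨H.symm, H.symm⟩
  have h3 : ∀ x y, ((H.LC s).LC m).Adj x y ↔ x ≠ y ∧
      Xor (x ≠ y ∧ Xor (H.Adj x y) (H.Adj s x ∧ H.Adj s y))
        ((H.LC s).Adj m x ∧ (H.LC s).Adj m y) := fun x y => Iff.rfl
  have h4 : (H.XM m s).Adj a b ↔ a ≠ b ∧
      Xor (((H.LC s).LC m).Adj a b ∧ a ≠ m ∧ b ≠ m)
        ((((H.LC s).LC m).Adj s a ∧ s ≠ m ∧ a ≠ m) ∧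
          (((H.LC s).LC m).Adj s b ∧ s ≠ m ∧ b ≠ m)) := Iff.rfl
  rw [h4, h2, h2, h3, h1, h1]
  have ha := hsymm a
  have hb := hsymm b
  by_cases ham : a = m
  · simp [ham, xor_def]
  by_cases hbm : b = m
  · simp [hbm, xor_def]
  by_cases hab : a = b
  · simp [hab]
  simp only [xor_def]
  by_cases has : a = s
  · subst has
    grind
  by_cases hbs : b = s
  · subst hbs
    grind
  by_cases hac : a = c
  · subst hac
    grind
  by_cases hbc : b = c
  · subst hbc
    grind
  grind

open Classical in
/-- The graph `H` arises from the bipartite graph `G` (with one side `S`) by merging the part `B`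
of `S` into a single star centre `c`, at the cost of removing the vertices in `M`. -/
structure IsMerged (G : FGraph α) (S : Finset α) (c : α) (B : Finset α) (M : Set α)
    (H : FGraph α) : Prop where
  minor : IsVertexMinor H G
  center_mem : c ∈ B
  subset : B ⊆ S
  verts_eq : H.verts = G.verts \ M
  notMem : ∀ m ∈ M, m ∉ S
  even : ∀ m ∈ M, ¬ Odd (S.filter (G.Adj m)).card
  nbr_mem : ∀ m ∈ M, ∀ s ∈ S, G.Adj m s → s ∈ B
  adj_inside : ∀ a ∈ S, ∀ b ∈ S,
    (H.Adj a b ↔ a ≠ b ∧ a ∈ B ∧ b ∈ B ∧ (a = c ∨ b = c))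
  adj_cross : ∀ a ∈ S, ∀ o, o ∉ S → (H.Adj a o ↔ o ∈ G.verts ∧ o ∉ M ∧
    ((a = c ∧ Odd (B.filter (G.Adj o)).card) ∨ (a ∉ B ∧ G.Adj a o)))
  adj_outside : ∀ a, a ∉ S → ∀ b, b ∉ S → ¬ H.Adj a b

/-- Two elements of `S` are linked if they are the only neighbours in `S` of some vertex
outside `S`. -/
def Linked (G : FGraph α) (S : Finset α) (a b : α) : Prop :=
  a ≠ b ∧ a ∈ S ∧ b ∈ S ∧ ∃ m, m ∉ S ∧ ∀ s ∈ S, G.Adj m s ↔ s = a ∨ s = b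

theorem Linked.symm {G : FGraph α} {S : Finset α} {a b : α} (h : G.Linked S a b) :
    G.Linked S b a := by
  obtain ⟨hne, ha, hb, m, hm, hadj⟩ := h
  exact ⟨hne.symm, hb, ha, m, hm, fun s hs => (hadj s hs).trans or_comm⟩

open Classical in
theorem IsMerged.insert {G H : FGraph α} {S B : Finset α} {c a s : α} {M : Set α}
    (h : IsMerged G S c B M H) (ha : a ∈ B) (hsB : s ∉ B) (hl : G.Linked S a s) :
    ∃ M' H', IsMerged G S c (insert s B) M' H' := by
  obtain ⟨hne, haS, hsS, m, hmS, hadj⟩ := hl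
  have hcS := h.subset h.center_mem
  have hcs : c ≠ s := fun e => hsB (e ▸ h.center_mem)
  have hms : G.Adj m s := (hadj s hsS).2 (Or.inr rfl)
  have hmG : m ∈ G.verts := (G.edge_mem hms).1
  have hmM : m ∉ M := fun hm => hsB (h.nbr_mem m hm s hsS hms)
  have hfB : B.filter (G.Adj m) = {a} := by
    ext x
    simp only [Finset.mem_filter, Finset.mem_singleton]
    constructor
    · rintro ⟨hx, hxm⟩
      rcases (hadj x (h.subset hx)).1 hxm with rfl | rfl
      · rfl
      · exact absurd hx hsB
    · rintro rfl
      exact ⟨ha, (hadj x haS).2 (Or.inl rfl)⟩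
  have hfS : S.filter (G.Adj m) = {a, s} := by
    ext x
    simp only [Finset.mem_filter, Finset.mem_insert, Finset.mem_singleton]
    constructor
    · rintro ⟨hx, hxm⟩
      exact (hadj x hx).1 hxm
    · rintro (rfl | rfl)
      · exact ⟨haS, (hadj x haS).2 (Or.inl rfl)⟩
      · exact ⟨hsS, hms⟩
  have hN : ∀ x, H.Adj m x ↔ x = c ∨ x = s := by
    intro x
    by_cases hx : x ∈ S
    · have h1 := h.adj_cross x hx m hmS
      have h2 : H.Adj m x ↔ H.Adj x m := ⟨H.symm, H.symm⟩
      have h3 : G.Adj x m ↔ x = a ∨ x = s :=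
        ⟨fun e => (hadj x hx).1 (G.symm e), fun e => G.symm ((hadj x hx).2 e)⟩
      rw [h2, h1, hfB, h3]
      simp only [hmG, hmM, Finset.card_singleton, odd_one]
      grind
    · have h1 := h.adj_outside m hmS x hx
      grind
  have hns : ¬ H.Adj s c := fun e => hsB ((h.adj_inside s hsS c hcS).1 e).2.1
  have hX := XM_adj_iff H hcs hns hN
  have hmem : ∀ x ∈ S, x ≠ m := fun x hx e => hmS (e ▸ hx)
  refine ⟨Insert.insert m M, H.XM m s, ?_, ?_, ?_, ?_, ?_, ?_, ?_, ?_, ?_, ?_⟩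
  · exact Relation.ReflTransGen.trans h.minor (isVertexMinor_XM H m s)
  · exact Finset.mem_insert_of_mem h.center_mem
  · exact Finset.insert_subset hsS h.subset
  · have : (H.XM m s).verts = H.verts \ {m} := rfl
    rw [this, h.verts_eq]
    ext x
    simp only [Set.mem_sdiff, Set.mem_singleton_iff, Set.mem_insert_iff]
    tauto
  · rintro x (rfl | hx)
    · exact hmS
    · exact h.notMem x hx
  · rintro x (rfl | hx)
    · rw [hfS, Finset.card_pair hne]
      decide
    · exact h.even x hx
  · rintro x (rfl | hx) t ht hxt
    · rcases (hadj t ht).1 hxt with rfl | rfl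
      · exact Finset.mem_insert_of_mem ha
      · exact Finset.mem_insert_self _ _
    · exact Finset.mem_insert_of_mem (h.nbr_mem x hx t ht hxt)
  · intro x hx y hy
    have h1 := h.adj_inside x hx y hy
    have h2 := h.adj_inside s hsS x hx
    have h3 := h.adj_inside s hsS y hy
    have h4 := hmem x hx
    have h5 := hmem y hy
    have h6 := h.center_mem
    rw [hX x y, h1, h2, h3]
    simp only [Finset.mem_insert, xor_def]
    grind
  · intro x hx o ho
    have h1 := h.adj_cross x hx o ho
    have h2 := h.adj_cross s hsS o ho
    have h3 := h.adj_inside s hsS x hx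
    have h4 := hmem x hx
    have hos : o ≠ s := fun e => ho (e ▸ hsS)
    have hoc : o ≠ c := fun e => ho (e ▸ hcS)
    have hxo : x ≠ o := fun e => ho (e ▸ hx)
    have h6 := h.center_mem
    have hcard : Odd ((Insert.insert s B).filter (G.Adj o)).card ↔
        Xor (Odd (B.filter (G.Adj o)).card) (G.Adj s o) := by
      have hsym : G.Adj s o ↔ G.Adj o s := ⟨G.symm, G.symm⟩
      rw [Finset.filter_insert, hsym]
      by_cases hos : G.Adj o s
      · rw [if_pos hos, Finset.card_insert_of_notMem (by simp [hsB])]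
        simp [hos, xor_def, Nat.odd_add_one]
      · simp [hos, xor_def]
    have hsG : G.Adj s o → o ∈ G.verts := fun e => (G.edge_mem e).2
    rw [hX x o, h1, h2, h3, hcard]
    simp only [Set.mem_insert_iff, Finset.mem_insert, xor_def]
    grind
  · intro x hx y hy hxy
    have h1 := h.adj_outside x hx y hy
    rw [hX x y] at hxy
    simp only [xor_def] at hxy
    grind

theorem exists_linked_boundary {G : FGraph α} {S B : Finset α} {c t : α}
    (hc : c ∈ B) (ht : t ∉ B) (h : Relation.ReflTransGen (G.Linked S) c t) :
    ∃ a ∈ B, ∃ s, s ∉ B ∧ G.Linked S a s := by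
  induction h with
  | refl => exact absurd hc ht
  | @tail b d _ hbd ih =>
    by_cases hb : b ∈ B
    · exact ⟨b, hb, d, ht, hbd⟩
    · exact ih hb

open Classical in
/-- If one side `S` of a bipartite graph is connected through vertices with exactly two neighbours
in `S`, then every set consisting of a point `c` of `S`, other points of `S`, and vertices with an
odd number of neighbours in `S` carries a star vertex-minor with centre `c`. -/
theorem exists_isStar_of_linked (G : FGraph α) (S : Finset α) (c : α)
    (hfin : G.verts.Finite) (hS : ∀ a ∈ S, ∀ b ∈ S, ¬ G.Adj a b)
    (hO : ∀ a, a ∉ S → ∀ b, b ∉ S → ¬ G.Adj a b) (hc : c ∈ S)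
    (hconn : ∀ s ∈ S, Relation.ReflTransGen (G.Linked S) c s)
    (V : Finset α) (hcV : c ∈ V) (hV : ∀ v ∈ V, v ∈ G.verts)
    (hodd : ∀ o ∈ V, o ∉ S → Odd (S.filter (G.Adj o)).card) :
    ∃ H : FGraph α, IsVertexMinor H G ∧ H.IsStar c ∧ H.verts = ↑V := by
  have hgrow : ∀ N : ℕ, ∀ B M H, IsMerged G S c B M H → (S \ B).card = N →
      ∃ M' H', IsMerged G S c S M' H' := by
    intro N
    induction N with
    | zero =>
      intro B M H h hN
      have : S = B := by
        rw [Finset.card_eq_zero, Finset.sdiff_eq_empty_iff_subset] at hN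
        exact hN.antisymm h.subset
      exact ⟨M, H, this ▸ h⟩
    | succ N ih =>
      intro B M H h hN
      obtain ⟨t, ht⟩ : (S \ B).Nonempty := Finset.card_pos.1 (by omega)
      rw [Finset.mem_sdiff] at ht
      obtain ⟨a, ha, s, hs, hl⟩ := exists_linked_boundary h.center_mem ht.2 (hconn t ht.1)
      obtain ⟨M', H', h'⟩ := h.insert ha hs hl
      refine ih _ M' H' h' ?_
      rw [Finset.sdiff_insert, Finset.card_erase_of_mem (by simp [hl.2.2.1, hs]), hN]
      rfl
  have hinit : IsMerged G S c {c} ∅ G := by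
    refine ⟨Relation.ReflTransGen.refl, by simp, by simpa using hc, by simp, by simp, by simp,
      by simp, ?_, ?_, hO⟩
    · intro a ha b hb
      have := hS a ha b hb
      simp only [Finset.mem_singleton]
      grind
    · intro a ha o ho
      have h1 : G.Adj a o → o ∈ G.verts := fun e => (G.edge_mem e).2
      have h2 : G.Adj o c ↔ G.Adj c o := ⟨G.symm, G.symm⟩
      have h3 : Odd (({c} : Finset α).filter (G.Adj o)).card ↔ G.Adj c o := by
        rw [Finset.filter_singleton, h2]
        by_cases h : G.Adj c o <;> simp [h]
      rw [h3]
      simp only [Set.mem_empty_iff_false, Finset.mem_singleton]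
      grind
  obtain ⟨M, H, h⟩ := hgrow _ _ _ _ hinit rfl
  obtain ⟨K, hK, hKv, hKadj⟩ := exists_isVertexMinor_delete H (hfin.toFinset \ V)
  have hVM : ∀ v ∈ V, v ∉ M := fun v hv hm => h.even v hm (hodd v hv (h.notMem v hm))
  have hverts : K.verts = ↑V := by
    rw [hKv, h.verts_eq]
    ext x
    have h1 := hV x
    have h2 := hVM x
    simp only [Set.mem_sdiff, Finset.coe_sdiff, Set.Finite.coe_toFinset, Finset.mem_coe]
    tauto
  refine ⟨K, Relation.ReflTransGen.trans h.minor hK, ⟨by simpa [hverts] using hcV, ?_⟩, hverts⟩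
  have hKV : ∀ a b, K.Adj a b → a ∈ V ∧ b ∈ V := by
    intro a b hab
    have := K.edge_mem hab
    simpa [hverts] using this
  have hKH : ∀ a ∈ V, ∀ b ∈ V, (K.Adj a b ↔ H.Adj a b) := by
    intro a ha b hb
    simp [hKadj, ha, hb]
  have hcross : ∀ a ∈ S, ∀ o ∈ V, o ∉ S → (H.Adj a o ↔ a = c) := by
    intro a ha o hoV ho
    rw [h.adj_cross a ha o ho]
    have h1 := hV o hoV
    have h2 := hVM o hoV
    have h3 := hodd o hoV ho
    simp only [h1, h2, h3, ha]
    simp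
  intro a b
  rw [hverts]
  simp only [Finset.mem_coe]
  by_cases haV : a ∈ V
  swap
  · exact ⟨fun e => absurd (hKV a b e).1 haV, fun e => absurd e.2.1 haV⟩
  by_cases hbV : b ∈ V
  swap
  · exact ⟨fun e => absurd (hKV a b e).2 hbV, fun e => absurd e.2.2.1 hbV⟩
  rw [hKH a haV b hbV]
  have hsymm : H.Adj a b ↔ H.Adj b a := ⟨H.symm, H.symm⟩
  by_cases ha : a ∈ S <;> by_cases hb : b ∈ S
  · rw [h.adj_inside a ha b hb]
    simp [ha, hb, haV, hbV]
  · rw [hcross a ha b hbV hb]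
    grind
  · rw [hsymm, hcross b hb a haV ha]
    grind
  · have := h.adj_outside a ha b hb
    grind

end FGraph

/-- The hubs: every second vertex of each row with index divisible by three, together with one
vertex in each following row. -/
def IsHub (n x y : ℕ) : Prop :=
  x < n ∧ y < n ∧ ((y % 3 = 0 ∧ x % 2 = y % 2) ∨ (y % 3 = 1 ∧ x = 1 + (y + 1) % 2))

open Classical in
noncomputable def hubs (n : ℕ) : Finset (ℕ × ℕ) :=
  (Finset.range n ×ˢ Finset.range n).filter fun p => IsHub n p.1 p.2

open Classical in
/-- The vertices in the colour class of the hubs that are not hubs. -/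
noncomputable def nonHubs (n : ℕ) : Finset (ℕ × ℕ) :=
  (Finset.range n ×ˢ Finset.range n).filter fun p => p.1 % 2 = p.2 % 2 ∧ ¬ IsHub n p.1 p.2

theorem mem_hubs {n x y : ℕ} : (x, y) ∈ hubs n ↔ IsHub n x y := by
  simp only [hubs, Finset.mem_filter, Finset.mem_product, Finset.mem_range]
  exact ⟨fun h => h.2, fun h => ⟨⟨h.1, h.2.1⟩, h⟩⟩

theorem mem_nonHubs {n x y : ℕ} :
    (x, y) ∈ nonHubs n ↔ x < n ∧ y < n ∧ x % 2 = y % 2 ∧ ¬ IsHub n x y := by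
  simp only [nonHubs, Finset.mem_filter, Finset.mem_product, Finset.mem_range]
  tauto

theorem IsHub.parity {n x y : ℕ} (h : IsHub n x y) : x % 2 = y % 2 := by
  unfold IsHub at h
  omega

theorem gridGraph_adj {n x y x' y' : ℕ} : (gridGraph n).Adj (x, y) (x', y') ↔
    x < n ∧ y < n ∧ x' < n ∧ y' < n ∧
      ((x = x' ∧ (y + 1 = y' ∨ y' + 1 = y)) ∨ (y = y' ∧ (x + 1 = x' ∨ x' + 1 = x))) :=
  Iff.rfl

/-- `G` is the grid graph with the non-hubs of the hub colour class removed. -/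
def IsHubGrid (n : ℕ) (G : FGraph (ℕ × ℕ)) : Prop :=
  ∀ p q, G.Adj p q ↔ (gridGraph n).Adj p q ∧ p ∉ nonHubs n ∧ q ∉ nonHubs n

theorem IsHubGrid.adj_hub {n : ℕ} {G : FGraph (ℕ × ℕ)} (hG : IsHubGrid n G) {x y u v : ℕ}
    (ho : x % 2 ≠ y % 2) (hs : IsHub n u v) :
    G.Adj (x, y) (u, v) ↔ (gridGraph n).Adj (x, y) (u, v) := by
  rw [hG, mem_nonHubs, mem_nonHubs]
  tauto

theorem IsHubGrid.not_adj_inside {n : ℕ} {G : FGraph (ℕ × ℕ)} (hG : IsHubGrid n G) :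
    ∀ a ∈ hubs n, ∀ b ∈ hubs n, ¬ G.Adj a b := by
  rintro ⟨x, y⟩ ha ⟨u, v⟩ hb h
  have h1 := (mem_hubs.1 ha).parity
  have h2 := (mem_hubs.1 hb).parity
  have h3 := gridGraph_adj.1 ((hG _ _).1 h).1
  omega

theorem IsHubGrid.not_adj_outside {n : ℕ} {G : FGraph (ℕ × ℕ)} (hG : IsHubGrid n G) :
    ∀ a, a ∉ hubs n → ∀ b, b ∉ hubs n → ¬ G.Adj a b := by
  rintro ⟨x, y⟩ ha ⟨u, v⟩ hb h
  obtain ⟨h1, h2, h3⟩ := (hG _ _).1 h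
  rw [mem_hubs] at ha hb
  rw [mem_nonHubs] at h2 h3
  rw [gridGraph_adj] at h1
  have h4 : ¬ x % 2 = y % 2 := fun e => h2 ⟨h1.1, h1.2.1, e, ha⟩
  have h5 : ¬ u % 2 = v % 2 := fun e => h3 ⟨h1.2.2.1, h1.2.2.2.1, e, hb⟩
  omega

theorem IsHubGrid.linked {n : ℕ} {G : FGraph (ℕ × ℕ)} (hG : IsHubGrid n G)
    {x y x' y' u v : ℕ} (ha : IsHub n x y) (hb : IsHub n x' y') (hne : x ≠ x' ∨ y ≠ y')
    (hm : u % 2 ≠ v % 2)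
    (h : ∀ s t, IsHub n s t →
      ((gridGraph n).Adj (u, v) (s, t) ↔ (s = x ∧ t = y) ∨ (s = x' ∧ t = y'))) :
    G.Linked (hubs n) (x, y) (x', y') := by
  refine ⟨?_, mem_hubs.2 ha, mem_hubs.2 hb, (u, v), ?_, ?_⟩
  · rw [Ne, Prod.mk.injEq]
    omega
  · rw [mem_hubs]
    exact fun e => hm e.parity
  · rintro ⟨s, t⟩ hs
    rw [mem_hubs] at hs
    rw [hG.adj_hub hm hs, h s t hs, Prod.mk.injEq, Prod.mk.injEq]

theorem IsHubGrid.linked_row {k n : ℕ} (hn : n = 6 * k + 4) {G : FGraph (ℕ × ℕ)}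
    (hG : IsHubGrid n G) {x y : ℕ} (hy : y % 3 = 0) (hyn : y < n) (hx : x + 2 < n)
    (hxy : x % 2 = y % 2) (h : 2 ≤ x ∨ y + 1 = n) :
    G.Linked (hubs n) (x, y) (x + 2, y) := by
  refine hG.linked (u := x + 1) (v := y) ?_ ?_ ?_ ?_ ?_
  · unfold IsHub; omega
  · unfold IsHub; omega
  · omega
  · omega
  · intro s t hs
    unfold IsHub at hs
    rw [gridGraph_adj]
    omega

theorem IsHubGrid.linked_left {k n : ℕ} (hn : n = 6 * k + 4) {G : FGraph (ℕ × ℕ)}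
    (hG : IsHubGrid n G) {y : ℕ} (hy : y % 3 = 0) (hyn : y + 1 < n) :
    G.Linked (hubs n) (y % 2, y) (1 + y % 2, y + 1) := by
  refine hG.linked (u := y % 2) (v := y + 1) ?_ ?_ ?_ ?_ ?_
  · unfold IsHub; omega
  · unfold IsHub; omega
  · omega
  · omega
  · intro s t hs
    unfold IsHub at hs
    rw [gridGraph_adj]
    omega

theorem IsHubGrid.linked_right {k n : ℕ} (hn : n = 6 * k + 4) {G : FGraph (ℕ × ℕ)}
    (hG : IsHubGrid n G) {y : ℕ} (hy : y % 3 = 0) (hyn : y + 1 < n) :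
    G.Linked (hubs n) (y % 2 + 2, y) (1 + y % 2, y + 1) := by
  refine hG.linked (u := y % 2 + 2) (v := y + 1) ?_ ?_ ?_ ?_ ?_
  · unfold IsHub; omega
  · unfold IsHub; omega
  · omega
  · omega
  · intro s t hs
    unfold IsHub at hs
    rw [gridGraph_adj]
    omega

theorem IsHubGrid.linked_up {k n : ℕ} (hn : n = 6 * k + 4) {G : FGraph (ℕ × ℕ)}
    (hG : IsHubGrid n G) {y : ℕ} (hy : y % 3 = 0) (hyn : y + 1 < n) :
    G.Linked (hubs n) (1 + y % 2, y + 1) (1 + y % 2, y + 3) := by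
  refine hG.linked (u := 1 + y % 2) (v := y + 2) ?_ ?_ ?_ ?_ ?_
  · unfold IsHub; omega
  · unfold IsHub; omega
  · omega
  · omega
  · intro s t hs
    unfold IsHub at hs
    rw [gridGraph_adj]
    omega

theorem IsHubGrid.reach_pair {k n : ℕ} (hn : n = 6 * k + 4) {G : FGraph (ℕ × ℕ)}
    (hG : IsHubGrid n G) (j : ℕ) (hj : 3 * j < n) :
    Relation.ReflTransGen (G.Linked (hubs n)) (0, 0) ((3 * j) % 2, 3 * j) ∧
      Relation.ReflTransGen (G.Linked (hubs n)) (0, 0) ((3 * j) % 2 + 2, 3 * j) := by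
  have hswap : ∀ j, 3 * j < n →
      (Relation.ReflTransGen (G.Linked (hubs n)) (0, 0) ((3 * j) % 2, 3 * j) ↔
        Relation.ReflTransGen (G.Linked (hubs n)) (0, 0) ((3 * j) % 2 + 2, 3 * j)) := by
    intro j hj
    by_cases hlast : 3 * j + 1 = n
    · have hl := hG.linked_row hn (x := (3 * j) % 2) (y := 3 * j) (by omega) hj (by omega)
        (by omega) (Or.inr hlast)
      exact ⟨fun h => h.tail hl, fun h => h.tail hl.symm⟩
    · have hl := hG.linked_left hn (y := 3 * j) (by omega) (by omega)
      have hr := hG.linked_right hn (y := 3 * j) (by omega) (by omega)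
      exact ⟨fun h => (h.tail hl).tail hr.symm, fun h => (h.tail hr).tail hl.symm⟩
  induction j with
  | zero => exact ⟨Relation.ReflTransGen.refl, (hswap 0 hj).1 Relation.ReflTransGen.refl⟩
  | succ j ih =>
    have hl := hG.linked_left hn (y := 3 * j) (by omega) (by omega)
    have hu := hG.linked_up hn (y := 3 * j) (by omega) (by omega)
    have hreach := ((ih (by omega)).1.tail hl).tail hu
    have hs := hswap (j + 1) hj
    rcases Nat.mod_two_eq_zero_or_one (3 * j) with h | h
    · have e : (1 + 3 * j % 2, 3 * j + 3) = ((3 * (j + 1)) % 2, 3 * (j + 1)) := by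
        rw [Prod.mk.injEq]; omega
      rw [e] at hreach
      exact ⟨hreach, hs.1 hreach⟩
    · have e : (1 + 3 * j % 2, 3 * j + 3) = ((3 * (j + 1)) % 2 + 2, 3 * (j + 1)) := by
        rw [Prod.mk.injEq]; omega
      rw [e] at hreach
      exact ⟨hs.2 hreach, hreach⟩

theorem IsHubGrid.reach_row {k n : ℕ} (hn : n = 6 * k + 4) {G : FGraph (ℕ × ℕ)}
    (hG : IsHubGrid n G) (j : ℕ) (hj : 3 * j < n) (i : ℕ) (hi : (3 * j) % 2 + 2 * i < n) :
    Relation.ReflTransGen (G.Linked (hubs n)) (0, 0) ((3 * j) % 2 + 2 * i, 3 * j) := by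
  induction i with
  | zero => exact (hG.reach_pair hn j hj).1
  | succ i ih =>
    rcases Nat.eq_zero_or_pos i with rfl | hi0
    · exact (hG.reach_pair hn j hj).2
    · exact (ih (by omega)).tail
        (hG.linked_row hn (by omega) hj (by omega) (by omega) (Or.inl (by omega)))

theorem IsHubGrid.reach {k n : ℕ} (hn : n = 6 * k + 4) {G : FGraph (ℕ × ℕ)}
    (hG : IsHubGrid n G) :
    ∀ s ∈ hubs n, Relation.ReflTransGen (G.Linked (hubs n)) (0, 0) s := by
  rintro ⟨x, y⟩ hs
  obtain ⟨hx, hy, ⟨h3, h2⟩ | ⟨h3, h2⟩⟩ := mem_hubs.1 hs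
  · have e : (x, y) = ((3 * (y / 3)) % 2 + 2 * (x / 2), 3 * (y / 3)) := by
      rw [Prod.mk.injEq]; omega
    rw [e]
    exact hG.reach_row hn (y / 3) (by omega) (x / 2) (by omega)
  · have hl := hG.linked_left hn (y := 3 * (y / 3)) (by omega) (by omega)
    have e : (x, y) = (1 + (3 * (y / 3)) % 2, 3 * (y / 3) + 1) := by
      rw [Prod.mk.injEq]; omega
    rw [e]
    exact (hG.reach_pair hn (y / 3) (by omega)).1.tail hl

/-- Non-hubs that have one or three hub neighbours. -/
def IsTip (n x y : ℕ) : Prop :=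
  x < n ∧ y < n ∧
    ((y % 3 = 0 ∧ y + 1 < n ∧ x = 1 + y % 2) ∨
      (y % 3 = 0 ∧ y % 2 = 0 ∧ x + 1 = n) ∨
      (y % 3 = 0 ∧ y % 2 = 1 ∧ x = 0) ∨
      (y % 3 = 1 ∧ x % 2 ≠ y % 2 ∧ x ≠ (y + 1) % 2 ∧ x ≠ 2 + (y + 1) % 2) ∨
      (y % 3 = 2 ∧ x % 2 ≠ y % 2 ∧ x ≠ 1 + y % 2))

open Classical in
theorem IsHubGrid.odd_of_unique {n : ℕ} {G : FGraph (ℕ × ℕ)} (hG : IsHubGrid n G)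
    {x y u v : ℕ} (ho : x % 2 ≠ y % 2)
    (h : ∀ s t, IsHub n s t ∧ (gridGraph n).Adj (x, y) (s, t) ↔ s = u ∧ t = v) :
    Odd ((hubs n).filter (G.Adj (x, y))).card := by
  have : (hubs n).filter (G.Adj (x, y)) = {(u, v)} := by
    ext ⟨s, t⟩
    rw [Finset.mem_filter, Finset.mem_singleton, Prod.mk.injEq, ← h, mem_hubs]
    exact and_congr_right fun hs => hG.adj_hub ho hs
  rw [this]
  simp

open Classical in
theorem IsHubGrid.odd_of_isTip {k n : ℕ} (hn : n = 6 * k + 4) {G : FGraph (ℕ × ℕ)}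
    (hG : IsHubGrid n G) {x y : ℕ} (h : IsTip n x y) :
    Odd ((hubs n).filter (G.Adj (x, y))).card := by
  obtain ⟨hx, hy, h | h | h | h | h⟩ := h
  · have ho : x % 2 ≠ y % 2 := by omega
    have : (hubs n).filter (G.Adj (x, y)) = {(x - 1, y), (x + 1, y), (x, y + 1)} := by
      ext ⟨s, t⟩
      have h1 : (s, t) ∈ hubs n ∧ G.Adj (x, y) (s, t) ↔
          IsHub n s t ∧ (gridGraph n).Adj (x, y) (s, t) := by
        rw [mem_hubs]
        exact and_congr_right fun hs => hG.adj_hub ho hs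
      rw [Finset.mem_filter, h1, gridGraph_adj, IsHub]
      simp only [Finset.mem_insert, Finset.mem_singleton, Prod.mk.injEq]
      omega
    rw [this, Finset.card_insert_of_notMem, Finset.card_pair]
    · decide
    · rw [Ne, Prod.mk.injEq]
      omega
    · simp only [Finset.mem_insert, Finset.mem_singleton, Prod.mk.injEq]
      omega
  · refine hG.odd_of_unique (u := n - 2) (v := y) (by omega) fun s t => ?_
    rw [gridGraph_adj, IsHub]
    omega
  · refine hG.odd_of_unique (u := 1) (v := y) (by omega) fun s t => ?_
    rw [gridGraph_adj, IsHub]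
    omega
  · refine hG.odd_of_unique (u := x) (v := y - 1) (by omega) fun s t => ?_
    rw [gridGraph_adj, IsHub]
    rcases Nat.mod_two_eq_zero_or_one y with e | e
    · have e' : (y + 1) % 2 = 1 := by omega
      rw [e, e'] at h
      constructor
      · rintro ⟨h1, h2⟩
        omega
      · omega
    · have e' : (y + 1) % 2 = 0 := by omega
      rw [e, e'] at h
      constructor
      · rintro ⟨h1, h2⟩
        omega
      · omega
  · refine hG.odd_of_unique (u := x) (v := y + 1) (by omega) fun s t => ?_
    rw [gridGraph_adj, IsHub]
    rcases Nat.mod_two_eq_zero_or_one y with e | e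
    · rw [e] at h
      constructor
      · rintro ⟨h1, h2⟩
        omega
      · omega
    · rw [e] at h
      constructor
      · rintro ⟨h1, h2⟩
        omega
      · omega

/-- An injection from an `n / 2 × n` rectangle into the hubs and tips. -/
def selectVertex (n : ℕ) (p : ℕ × ℕ) : ℕ × ℕ :=
  if p.2 % 3 = 0 then (2 * p.1 + p.2 % 2, p.2)
  else if p.2 % 3 = 1 then
    if p.1 = 0 then (1 + (p.2 + 1) % 2, p.2)
    else if p.1 = 1 then (1 + (p.2 + 1) % 2, p.2 - 1)
    else (2 * p.1 + (p.2 + 1) % 2, p.2)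
  else if p.1 = p.2 % 2 then
    if p.2 % 2 = 0 then (n - 1, p.2 - 2) else (0, p.2 - 2)
  else (2 * p.1 + (p.2 + 1) % 2, p.2)

theorem selectVertex_mem {k n : ℕ} (hn : n = 6 * k + 4) {i y : ℕ} (hi : i < 3 * k + 2)
    (hy : y < n) :
    IsHub n (selectVertex n (i, y)).1 (selectVertex n (i, y)).2 ∨
      IsTip n (selectVertex n (i, y)).1 (selectVertex n (i, y)).2 := by
  unfold selectVertex
  dsimp only
  split_ifs
  · left; unfold IsHub; dsimp only; omega
  · left; unfold IsHub; dsimp only; omega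
  · right; unfold IsTip; dsimp only; omega
  · right; unfold IsTip; dsimp only; omega
  · right; unfold IsTip; dsimp only; omega
  · right; unfold IsTip; dsimp only; omega
  · exact Or.inr ⟨by omega, hy, Or.inr (Or.inr (Or.inr (Or.inr (by omega))))⟩

theorem selectVertex_injective {k n : ℕ} (hn : n = 6 * k + 4) {i y j z : ℕ}
    (h : selectVertex n (i, y) = selectVertex n (j, z)) : i = j ∧ y = z := by
  unfold selectVertex at h
  dsimp only at h
  split_ifs at h <;> rw [Prod.mk.injEq] at h <;> omega

open Classical in
theorem card_hubs_tips {k n : ℕ} (hn : n = 6 * k + 4) :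
    18 * k ^ 2 + 19 * k + 8 ≤ ((Finset.range n ×ˢ Finset.range n).filter
      fun p => IsHub n p.1 p.2 ∨ IsTip n p.1 p.2).card := by
  have hle : (Finset.range (3 * k + 2) ×ˢ Finset.range n).card ≤
      ((Finset.range n ×ˢ Finset.range n).filter
        fun p => IsHub n p.1 p.2 ∨ IsTip n p.1 p.2).card := by
    refine Finset.card_le_card_of_injOn (selectVertex n) ?_ ?_
    · rintro ⟨i, y⟩ hp
      simp only [Finset.coe_product, Finset.coe_range, Set.mem_prod, Set.mem_Iio] at hp
      have h := selectVertex_mem hn hp.1 hp.2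
      simp only [Finset.coe_filter, Finset.mem_product, Finset.mem_range, Set.mem_ofPred_eq]
      refine ⟨?_, h⟩
      rcases h with h | h
      · exact ⟨h.1, h.2.1⟩
      · exact ⟨h.1, h.2.1⟩
    · rintro ⟨i, y⟩ - ⟨j, z⟩ - h
      rw [Prod.mk.injEq]
      exact selectVertex_injective hn h
  rw [Finset.card_product, Finset.card_range, Finset.card_range] at hle
  subst hn
  nlinarith

/-- for `n = 6k + 4` (`k ≥ 0`), the star graph on 18 * k ^ 2 + 19 * k + 8 vertices is a
vertex-minor of the `n × n` grid graph. -/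
theorem grid_star_vertexMinor_19 (k n : ℕ)  (hn : n = 6 * k + 4) :
    ∃ (H : FGraph (ℕ × ℕ)) (c : ℕ × ℕ),
      FGraph.IsVertexMinor H (gridGraph n) ∧ H.IsStar c ∧
      H.verts.ncard = 18 * k ^ 2 + 19 * k + 8 := by
  classical
  obtain ⟨G, hmin, hverts, hadj⟩ :=
    FGraph.exists_isVertexMinor_delete (gridGraph n) (nonHubs n)
  have hG : IsHubGrid n G := hadj
  have hfin : G.verts.Finite := by
    rw [hverts]
    refine Set.Finite.subset (Finset.range n ×ˢ Finset.range n).finite_toSet ?_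
    rintro ⟨x, y⟩ ⟨hp, -⟩
    simpa [gridGraph] using hp
  have hc : ((0, 0) : ℕ × ℕ) ∈ hubs n := by
    rw [mem_hubs, IsHub]
    omega
  obtain ⟨V, hcV, hVsub, hVcard⟩ := Finset.exists_subsuperset_card_eq
    (s := {((0, 0) : ℕ × ℕ)}) (n := 18 * k ^ 2 + 19 * k + 8)
    (t := (Finset.range n ×ˢ Finset.range n).filter fun p => IsHub n p.1 p.2 ∨ IsTip n p.1 p.2)
    (by
      rw [Finset.singleton_subset_iff, Finset.mem_filter]
      exact ⟨by simp [hn], Or.inl (mem_hubs.1 hc)⟩)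
    (by rw [Finset.card_singleton]; omega) (card_hubs_tips hn)
  have hV : ∀ p ∈ V, (p.1 < n ∧ p.2 < n) ∧ (IsHub n p.1 p.2 ∨ IsTip n p.1 p.2) := by
    intro p hp
    simpa using hVsub hp
  obtain ⟨H, hH, hstar, hHv⟩ := FGraph.exists_isStar_of_linked G (hubs n) (0, 0) hfin
    hG.not_adj_inside hG.not_adj_outside hc (hG.reach hn) V (hcV (by simp))
    (by
      rintro ⟨x, y⟩ hp
      obtain ⟨h1, h2⟩ := hV _ hp
      rw [hverts]
      refine ⟨h1, ?_⟩
      rw [Finset.mem_coe, mem_nonHubs]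
      rintro ⟨-, -, h3, h4⟩
      rcases h2 with h2 | h2
      · exact h4 h2
      · unfold IsTip at h2
        dsimp only at h2
        omega)
    (by
      rintro ⟨x, y⟩ hp hnot
      rw [mem_hubs] at hnot
      exact hG.odd_of_isTip hn ((hV _ hp).2.resolve_left hnot))
  exact ⟨H, (0, 0), Relation.ReflTransGen.trans hmin hH, hstar,
    by rw [hHv, Set.ncard_coe_finset, hVcard]⟩
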